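/- arXiv:2405.03249 — 2 statements merged into one kernel-verified Lean document; each statement's English description precedes it below -/
import Mathlib

section
/- Let g = (g1,g2) be a vector field on ℝ² with smooth (C³) components compactly supported in the open unit disk, and let f = d⊥g, i.e. f11 = -∂g1/∂x2, f12 = (1/2)·(∂g1/∂x1 - ∂g2/∂x2), f22 = ∂g2/∂x1. Then for every x ∈ ℝ², g1(x) = (1/(2·u2))·Tf(x). -/
open MeasureTheory

noncomputable section

/-- Rotation of a vector by 90 degrees: `w⊥ = (-w2, w1)`. -/
def perp (w : ℝ × ℝ) : ℝ × ℝ := (-w.2, w.1)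

/-- Divergent beam transform `X_w h (x) = ∫_0^∞ h(x + t w) dt`. -/
def Xray (w : ℝ × ℝ) (h : ℝ × ℝ → ℝ) (x : ℝ × ℝ) : ℝ :=
  ∫ t in Set.Ioi (0:ℝ), h (x + t • w)

/-- First moment divergent beam transform `X¹_w h (x) = ∫_0^∞ t·h(x + t w) dt`. -/
def Xray1 (w : ℝ × ℝ) (h : ℝ × ℝ → ℝ) (x : ℝ × ℝ) : ℝ :=
  ∫ t in Set.Ioi (0:ℝ), t * h (x + t • w)

/-- Directional derivative `D_w h = w1 ∂h/∂x1 + w2 ∂h/∂x2`. -/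
def Dw (w : ℝ × ℝ) (h : ℝ × ℝ → ℝ) (x : ℝ × ℝ) : ℝ :=
  fderiv ℝ h x w

/-- Partial derivative in the first coordinate. -/
def pdx (h : ℝ × ℝ → ℝ) : ℝ × ℝ → ℝ := Dw (1, 0) h

/-- Partial derivative in the second coordinate. -/
def pdy (h : ℝ × ℝ → ℝ) : ℝ × ℝ → ℝ := Dw (0, 1) h

/-- The open unit disk in ℝ². -/
def unitDisk : Set (ℝ × ℝ) := {x | x.1 ^ 2 + x.2 ^ 2 < 1}

/-- `⟨f, w²⟩ = f11 w1² + 2 f12 w1 w2 + f22 w2²`. -/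
def proj2 (f11 f12 f22 : ℝ × ℝ → ℝ) (w : ℝ × ℝ) (x : ℝ × ℝ) : ℝ :=
  f11 x * w.1 ^ 2 + 2 * f12 x * w.1 * w.2 + f22 x * w.2 ^ 2

/-- `⟨f, w ⊙ w⊥⟩ = -f11 w1 w2 + f12 (w1² - w2²) + f22 w1 w2`. -/
def projMix (f11 f12 f22 : ℝ × ℝ → ℝ) (w : ℝ × ℝ) (x : ℝ × ℝ) : ℝ :=
  -(f11 x) * w.1 * w.2 + f12 x * (w.1 ^ 2 - w.2 ^ 2) + f22 x * w.1 * w.2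

/-- V-line transform of a scalar function. -/
def Vlt (u v : ℝ × ℝ) (h : ℝ × ℝ → ℝ) (x : ℝ × ℝ) : ℝ := Xray u h x + Xray v h x

/-- Longitudinal V-line transform. -/
def Lf (u v : ℝ × ℝ) (f11 f12 f22 : ℝ × ℝ → ℝ) (x : ℝ × ℝ) : ℝ :=
  Xray u (proj2 f11 f12 f22 u) x + Xray v (proj2 f11 f12 f22 v) x

/-- Transverse V-line transform. -/
def Tf (u v : ℝ × ℝ) (f11 f12 f22 : ℝ × ℝ → ℝ) (x : ℝ × ℝ) : ℝ :=
  Xray u (proj2 f11 f12 f22 (perp u)) x + Xray v (proj2 f11 f12 f22 (perp v)) x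

/-- Mixed V-line transform. -/
def Mf (u v : ℝ × ℝ) (f11 f12 f22 : ℝ × ℝ → ℝ) (x : ℝ × ℝ) : ℝ :=
  Xray u (projMix f11 f12 f22 u) x + Xray v (projMix f11 f12 f22 v) x

/-- First moment longitudinal V-line transform. -/
def L1f (u v : ℝ × ℝ) (f11 f12 f22 : ℝ × ℝ → ℝ) (x : ℝ × ℝ) : ℝ :=
  Xray1 u (proj2 f11 f12 f22 u) x + Xray1 v (proj2 f11 f12 f22 v) x

/-- The divergent beam transform inverts directional differentiation along the beam. -/
theorem Xray_Dw {w : ℝ × ℝ} (hw : w ≠ 0) {h : ℝ × ℝ → ℝ} (hh : ContDiff ℝ 1 h)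
    (hsupp : HasCompactSupport h) (x : ℝ × ℝ) : Xray w (Dw w h) x = -h x := by
  have hemb : Topology.IsClosedEmbedding fun t : ℝ => x + t • w :=
    (Homeomorph.addLeft x).isClosedEmbedding.comp (isClosedEmbedding_smul_left hw)
  have hderiv (t : ℝ) : deriv (fun s : ℝ => h (x + s • w)) t = Dw w h (x + t • w) := by
    have hline : HasDerivAt (fun s : ℝ => x + s • w) w t := by
      simpa using ((hasDerivAt_id t).smul_const w).const_add x
    exact ((hh.differentiable one_ne_zero _).hasFDerivAt.comp_hasDerivAt t hline).deriv
  have hint := (hsupp.comp_isClosedEmbedding hemb).integral_Ioi_deriv_eq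
    (hh.comp (by fun_prop)) 0
  simpa [Xray, Function.comp_def, hderiv] using hint

/-- A function supported in the open unit disk has compact support. -/
theorem hasCompactSupport_of_tsupport_subset_unitDisk {h : ℝ × ℝ → ℝ}
    (hsupp : tsupport h ⊆ unitDisk) : HasCompactSupport h := by
  refine HasCompactSupport.of_support_subset_isCompact
    ((isCompact_Icc (a := (-1 : ℝ)) (b := 1)).prod (isCompact_Icc (a := (-1 : ℝ)) (b := 1))) ?_
  intro y hy
  have hlt : y.1 ^ 2 + y.2 ^ 2 < 1 := hsupp (subset_tsupport h hy)
  refine ⟨⟨?_, ?_⟩, ⟨?_, ?_⟩⟩ <;> nlinarith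

theorem Dw_eq (w : ℝ × ℝ) (h : ℝ × ℝ → ℝ) (x : ℝ × ℝ) :
    Dw w h x = w.1 * pdx h x + w.2 * pdy h x := by
  have hw : w = w.1 • ((1, 0) : ℝ × ℝ) + w.2 • ((0, 1) : ℝ × ℝ) := by
    ext <;> simp
  conv_lhs => rw [Dw, hw, map_add, map_smul, map_smul]
  rfl

/-- The transverse projection of `d⊥g` is the directional derivative of `⟨g, w⊥⟩`. -/
theorem proj2_perp_eq_Dw (w : ℝ × ℝ) {g1 g2 : ℝ × ℝ → ℝ} (hg1 : Differentiable ℝ g1)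
    (hg2 : Differentiable ℝ g2) :
    proj2 (fun x => -(pdy g1 x)) (fun x => (1 / 2) * (pdx g1 x - pdy g2 x)) (pdx g2) (perp w) =
      Dw w (fun y => w.1 * g2 y - w.2 * g1 y) := by
  ext x
  have hD : Dw w (fun y => w.1 * g2 y - w.2 * g1 y) x = w.1 * Dw w g2 x - w.2 * Dw w g1 x := by
    simp only [Dw]
    rw [(((hg2 x).hasFDerivAt.const_mul w.1).fun_sub ((hg1 x).hasFDerivAt.const_mul w.2)).fderiv]
    simp
  rw [hD, Dw_eq, Dw_eq]
  simp only [proj2, perp]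
  ring

/-- The transverse beam transform of `d⊥g` recovers `-⟨g, w⊥⟩`. -/
theorem Xray_proj2_perp {w : ℝ × ℝ} (hw : w ≠ 0) {g1 g2 : ℝ × ℝ → ℝ} (hg1 : ContDiff ℝ 1 g1)
    (hg2 : ContDiff ℝ 1 g2) (hs1 : HasCompactSupport g1) (hs2 : HasCompactSupport g2)
    (x : ℝ × ℝ) :
    Xray w (proj2 (fun x => -(pdy g1 x)) (fun x => (1 / 2) * (pdx g1 x - pdy g2 x)) (pdx g2)
      (perp w)) x = w.2 * g1 x - w.1 * g2 x := by
  rw [proj2_perp_eq_Dw w (hg1.differentiable one_ne_zero) (hg2.differentiable one_ne_zero),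
    Xray_Dw hw (by fun_prop) ?_, neg_sub]
  exact (hs2.mul_left (f := fun _ => w.1)).sub (hs1.mul_left (f := fun _ => w.2))

theorem stmt_6 (u1 u2 : ℝ) (hu1 : 0 < u1) (hu2 : 0 < u2) (huv : u1 ^ 2 + u2 ^ 2 = 1)
    (g1 g2 : ℝ × ℝ → ℝ) (hg1 : ContDiff ℝ 3 g1) (hg2 : ContDiff ℝ 3 g2)
    (hg1supp : tsupport g1 ⊆ unitDisk) (hg2supp : tsupport g2 ⊆ unitDisk)
    (f11 f12 f22 : ℝ × ℝ → ℝ)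
    (hf11 : f11 = fun x => -(pdy g1 x))
    (hf12 : f12 = fun x => (1 / 2) * (pdx g1 x - pdy g2 x))
    (hf22 : f22 = pdx g2) :
    ∀ x : ℝ × ℝ, g1 x = (1 / (2 * u2)) * Tf (u1, u2) (-u1, u2) f11 f12 f22 x := by
  intro x
  subst hf11 hf12 hf22
  have hs1 := hasCompactSupport_of_tsupport_subset_unitDisk hg1supp
  have hs2 := hasCompactSupport_of_tsupport_subset_unitDisk hg2supp
  have hC1 : ContDiff ℝ 1 g1 := hg1.of_le (by norm_num)
  have hC2 : ContDiff ℝ 1 g2 := hg2.of_le (by norm_num)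
  rw [Tf, Xray_proj2_perp (by simp [hu1.ne']) hC1 hC2 hs1 hs2,
    Xray_proj2_perp (by simp [hu1.ne']) hC1 hC2 hs1 hs2]
  field_simp
  ring
end
end

section
/- Let f = (f11,f12,f22) be a symmetric 2-tensor field with smooth (C³) components compactly supported in the open unit disk, and assume u1 ≠ u2. Set a = 2·u1²·(1 + (u1² - u2²)), b = (u1² - u2²)², and g(x) = (1/(2·u2))·[ u1²·∂/∂x1( D_u D_v (Tf - Lf) )(x) + (u1² - u2²)·∂/∂x2( D_u D_v (Mf) )(x) ]. Then f12 satisfies, at every x ∈ ℝ², the elliptic equation a·∂²f12/∂x1²(x) + b·∂²f12/∂x2²(x) = -g(x). -/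
open MeasureTheory

noncomputable section

/-- A compactly supported function vanishes far out along a ray, uniformly for base points near
`x₀`. -/
lemma exists_forall_ray_eq_zero {E : Type*} [Zero E] {h : ℝ × ℝ → E} (hc : HasCompactSupport h)
    {w : ℝ × ℝ} (hw : w ≠ 0) (x₀ : ℝ × ℝ) :
    ∃ R : ℝ, ∀ x ∈ Metric.ball x₀ 1, ∀ t : ℝ, R < |t| → h (x + t • w) = 0 := by
  obtain ⟨r, hr⟩ := hc.isCompact.isBounded.exists_norm_le
  have hw' : 0 < ‖w‖ := norm_pos_iff.mpr hw
  refine ⟨(r + ‖x₀‖ + 1) / ‖w‖, fun x hx t ht => ?_⟩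
  by_contra hne
  have hle := hr _ (subset_tsupport h hne)
  have hxn : ‖x‖ ≤ ‖x₀‖ + 1 := by
    have := norm_le_norm_add_norm_sub' x x₀
    rw [Metric.mem_ball, dist_eq_norm] at hx
    linarith
  have htw : ‖t • w‖ ≤ ‖x + t • w‖ + ‖x‖ := by
    simpa using norm_sub_le (x + t • w) x
  rw [norm_smul, Real.norm_eq_abs] at htw
  rw [div_lt_iff₀ hw'] at ht
  linarith

lemma hasCompactSupport_ray {E : Type*} [Zero E] {h : ℝ × ℝ → E} (hc : HasCompactSupport h)
    {w : ℝ × ℝ} (hw : w ≠ 0) (x : ℝ × ℝ) : HasCompactSupport fun t : ℝ => h (x + t • w) := by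
  obtain ⟨R, hR⟩ := exists_forall_ray_eq_zero hc hw x
  refine HasCompactSupport.intro (isCompact_closedBall (0 : ℝ) R) fun t ht => ?_
  refine hR x (Metric.mem_ball_self one_pos) t ?_
  simpa using ht

lemma integrable_ray {E : Type*} [NormedAddCommGroup E] {h : ℝ × ℝ → E} (hh : Continuous h)
    (hc : HasCompactSupport h) {w : ℝ × ℝ} (hw : w ≠ 0) (x : ℝ × ℝ) :
    IntegrableOn (fun t : ℝ => h (x + t • w)) (Set.Ioi 0) :=
  ((by fun_prop : Continuous fun t : ℝ => h (x + t • w)).integrable_of_hasCompactSupport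
    (hasCompactSupport_ray hc hw x)).integrableOn

/-- The divergent beam transform may be differentiated under the integral sign. -/
lemma hasFDerivAt_Xray {h : ℝ × ℝ → ℝ} (hh : ContDiff ℝ 1 h) (hc : HasCompactSupport h)
    {w : ℝ × ℝ} (hw : w ≠ 0) (x₀ : ℝ × ℝ) :
    HasFDerivAt (Xray w h) (∫ t in Set.Ioi (0 : ℝ), fderiv ℝ h (x₀ + t • w)) x₀ := by
  have hc' : HasCompactSupport (fderiv ℝ h) := hc.fderiv (𝕜 := ℝ)
  have hcont : Continuous (fderiv ℝ h) := hh.continuous_fderiv one_ne_zero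
  obtain ⟨C, hC⟩ := hc'.exists_bound_of_continuous hcont
  obtain ⟨R, hR⟩ := exists_forall_ray_eq_zero hc' hw x₀
  have hhc := hh.continuous
  refine hasFDerivAt_integral_of_dominated_of_fderiv_le
    (F := fun x t => h (x + t • w)) (F' := fun x t => fderiv ℝ h (x + t • w))
    (bound := (Set.Iic R).indicator fun _ => C) (Metric.ball_mem_nhds x₀ one_pos)
    (Filter.Eventually.of_forall fun x =>
      (by fun_prop : Continuous fun t : ℝ => h (x + t • w)).aestronglyMeasurable)
    (integrable_ray hhc hc hw x₀)
    (by fun_prop : Continuous fun t : ℝ => fderiv ℝ h (x₀ + t • w)).aestronglyMeasurable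
    ?_ ?_ ?_
  · refine Filter.Eventually.of_forall fun t x hx => ?_
    by_cases ht : t ≤ R
    · simpa [ht] using hC (x + t • w)
    · simp [ht, hR x hx t ((not_le.mp ht).trans_le (le_abs_self t))]
  · rw [integrable_indicator_iff measurableSet_Iic, IntegrableOn,
      Measure.restrict_restrict measurableSet_Iic, Set.Iic_inter_Ioi]
    exact integrableOn_const (by simp)
  · refine Filter.Eventually.of_forall fun t x _ => ?_
    exact (hasFDerivAt_comp_add_right (t • w)).mpr
      (hh.differentiable one_ne_zero).differentiableAt.hasFDerivAt

lemma Dw_Xray {h : ℝ × ℝ → ℝ} (hh : ContDiff ℝ 1 h) (hc : HasCompactSupport h)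
    {w : ℝ × ℝ} (hw : w ≠ 0) (z x : ℝ × ℝ) : Dw z (Xray w h) x = Xray w (Dw z h) x := by
  rw [Dw, (hasFDerivAt_Xray hh hc hw x).fderiv, ContinuousLinearMap.integral_apply
    (integrable_ray (hh.continuous_fderiv one_ne_zero) (hc.fderiv (𝕜 := ℝ)) hw x)]
  rfl

lemma Xray_Dw_self {h : ℝ × ℝ → ℝ} (hh : ContDiff ℝ 1 h) (hc : HasCompactSupport h)
    {w : ℝ × ℝ} (hw : w ≠ 0) (x : ℝ × ℝ) : Xray w (Dw w h) x = -h x := by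
  have hderiv : ∀ t : ℝ, deriv (fun t : ℝ => h (x + t • w)) t = Dw w h (x + t • w) := fun t =>
    (((hh.differentiable one_ne_zero).differentiableAt.hasFDerivAt).comp_hasDerivAt t
      (by simpa using ((hasDerivAt_id t).smul_const w).const_add x)).deriv
  have := (hasCompactSupport_ray hc hw x).integral_Ioi_deriv_eq
    (by fun_prop : ContDiff ℝ 1 fun t : ℝ => h (x + t • w)) 0
  simpa [hderiv, Xray] using this

lemma contDiff_Dw {m n : WithTop ℕ∞} {h : ℝ × ℝ → ℝ} (hh : ContDiff ℝ n h) (hmn : m + 1 ≤ n)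
    (w : ℝ × ℝ) : ContDiff ℝ m (Dw w h) :=
  (hh.fderiv_right hmn).clm_apply contDiff_const

lemma hasCompactSupport_Dw {h : ℝ × ℝ → ℝ} (hc : HasCompactSupport h) (w : ℝ × ℝ) :
    HasCompactSupport (Dw w h) :=
  hc.fderiv_apply (𝕜 := ℝ) w

lemma Dw_linear_combination {p q : ℝ × ℝ → ℝ} (hp : Differentiable ℝ p) (hq : Differentiable ℝ q)
    (α β : ℝ) (w x : ℝ × ℝ) :
    Dw w (fun y => α * p y + β * q y) x = α * Dw w p x + β * Dw w q x := by
  have := ((hp x).hasFDerivAt.const_mul α).add ((hq x).hasFDerivAt.const_mul β)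
  simp only [Dw]
  rw [HasFDerivAt.fderiv (f := fun y => α * p y + β * q y) this]
  simp

lemma Dw_eq_pdx_pdy (h : ℝ × ℝ → ℝ) (w x : ℝ × ℝ) :
    Dw w h x = w.1 * pdx h x + w.2 * pdy h x := by
  have hw : w = w.1 • ((1, 0) : ℝ × ℝ) + w.2 • ((0, 1) : ℝ × ℝ) := by simp
  conv_lhs => rw [hw]
  simp only [Dw, pdx, pdy, map_add, map_smul, smul_eq_mul]

lemma Dw_comm {h : ℝ × ℝ → ℝ} (hh : ContDiff ℝ 2 h) (w z x : ℝ × ℝ) :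
    Dw w (Dw z h) x = Dw z (Dw w h) x := by
  have hd : DifferentiableAt ℝ (fderiv ℝ h) x :=
    (hh.fderiv_right (m := 1) (by norm_num)).differentiable one_ne_zero x
  have key : ∀ a b : ℝ × ℝ, Dw a (Dw b h) x = fderiv ℝ (fderiv ℝ h) x a b := fun a b => by
    change fderiv ℝ (fun y => fderiv ℝ h y b) x a = _
    rw [fderiv_clm_apply hd (differentiableAt_const b)]
    simp
  rw [key, key]
  exact (hh.contDiffAt.isSymmSndFDerivAt (by simp)) w z

lemma Xray_sub {p q : ℝ × ℝ → ℝ} (hp : Continuous p) (hpc : HasCompactSupport p)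
    (hq : Continuous q) (hqc : HasCompactSupport q) {w : ℝ × ℝ} (hw : w ≠ 0) (x : ℝ × ℝ) :
    Xray w (fun y => p y - q y) x = Xray w p x - Xray w q x :=
  integral_sub (integrable_ray hp hpc hw x) (integrable_ray hq hqc hw x)

/-- The operator `D_u D_v` inverts a sum of two beam transforms up to first derivatives. -/
lemma Dw_Dw_Xray_add {p q : ℝ × ℝ → ℝ} (hp : ContDiff ℝ 2 p) (hpc : HasCompactSupport p)
    (hq : ContDiff ℝ 2 q) (hqc : HasCompactSupport q) {u v : ℝ × ℝ} (hu : u ≠ 0) (hv : v ≠ 0)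
    (x : ℝ × ℝ) :
    Dw u (Dw v (fun y => Xray u p y + Xray v q y)) x = -Dw v p x - Dw u q x := by
  have hp1 : ContDiff ℝ 1 p := hp.of_le (by norm_num)
  have hq1 : ContDiff ℝ 1 q := hq.of_le (by norm_num)
  have hDp : ContDiff ℝ 1 (Dw v p) := contDiff_Dw hp (by norm_num) v
  have hDpc := hasCompactSupport_Dw hpc v
  have first : Dw v (fun y => Xray u p y + Xray v q y)
      = fun y => 1 * Xray u (Dw v p) y + (-1) * q y := by
    funext y
    have := Dw_linear_combination (fun x => (hasFDerivAt_Xray hp1 hpc hu x).differentiableAt)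
      (fun x => (hasFDerivAt_Xray hq1 hqc hv x).differentiableAt) 1 1 v y
    simp only [one_mul] at this
    rw [this, Dw_Xray hp1 hpc hu, Dw_Xray hq1 hqc hv, Xray_Dw_self hq1 hqc hv]
    ring
  rw [first, Dw_linear_combination (fun x => (hasFDerivAt_Xray hDp hDpc hu x).differentiableAt)
    (hq1.differentiable one_ne_zero), Dw_Xray hDp hDpc hu, Xray_Dw_self hDp hDpc hu]
  ring

lemma hasCompactSupport_of_tsupport_subset_unitDisk_s11 {f : ℝ × ℝ → ℝ}
    (hf : tsupport f ⊆ unitDisk) : HasCompactSupport f := by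
  refine (isCompact_closedBall (0 : ℝ × ℝ) 1).of_isClosed_subset (isClosed_tsupport f)
    fun x hx => ?_
  have hx' : x.1 ^ 2 + x.2 ^ 2 < 1 := hf hx
  rw [mem_closedBall_zero_iff, Prod.norm_def]
  exact max_le (abs_le_one_iff_mul_self_le_one.mpr (by nlinarith [sq_nonneg x.2]))
    (abs_le_one_iff_mul_self_le_one.mpr (by nlinarith [sq_nonneg x.1]))

lemma HasCompactSupport.linear_combination {p q : ℝ × ℝ → ℝ} (hp : HasCompactSupport p)
    (hq : HasCompactSupport q) (α β : ℝ) : HasCompactSupport fun y => α * p y + β * q y :=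
  (hp.mul_left (f := fun _ => α)).add (hq.mul_left (f := fun _ => β))

section Fields

variable {f11 f12 f22 : ℝ × ℝ → ℝ}

lemma contDiff_proj2 {n : WithTop ℕ∞} (h11 : ContDiff ℝ n f11) (h12 : ContDiff ℝ n f12)
    (h22 : ContDiff ℝ n f22) (w : ℝ × ℝ) : ContDiff ℝ n (proj2 f11 f12 f22 w) := by
  unfold proj2
  fun_prop

lemma hasCompactSupport_proj2 (h11 : HasCompactSupport f11) (h12 : HasCompactSupport f12)
    (h22 : HasCompactSupport f22) (w : ℝ × ℝ) : HasCompactSupport (proj2 f11 f12 f22 w) := by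
  convert (h11.linear_combination h12 (w.1 ^ 2) (2 * w.1 * w.2)).linear_combination h22 1
    (w.2 ^ 2) using 1
  funext y
  simp only [proj2]
  ring

/-- `D_u D_v (Tf - Lf)` as a combination of first derivatives of `f22 - f11` and `f12`. -/
lemma Dw_Dw_Tf_sub_Lf {u1 u2 : ℝ} (hu1 : 0 < u1)
    (h11 : ContDiff ℝ 2 f11) (h12 : ContDiff ℝ 2 f12) (h22 : ContDiff ℝ 2 f22)
    (c11 : HasCompactSupport f11) (c12 : HasCompactSupport f12) (c22 : HasCompactSupport f22)
    (x : ℝ × ℝ) :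
    Dw (u1, u2) (Dw (-u1, u2) fun y =>
        Tf (u1, u2) (-u1, u2) f11 f12 f22 y - Lf (u1, u2) (-u1, u2) f11 f12 f22 y) x =
      (-2 * u2 * (u1 ^ 2 - u2 ^ 2)) * pdy (fun y => f22 y - f11 y) x +
        (-8 * u1 ^ 2 * u2) * pdx f12 x := by
  have hu : ((u1, u2) : ℝ × ℝ) ≠ 0 := fun h => hu1.ne' (congrArg Prod.fst h)
  have hv : ((-u1, u2) : ℝ × ℝ) ≠ 0 := fun h => hu1.ne' (neg_eq_zero.mp (congrArg Prod.fst h))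
  have hF : ContDiff ℝ 2 fun y => f22 y - f11 y := h22.sub h11
  have cF : HasCompactSupport fun y => f22 y - f11 y := c22.sub c11
  have hproj := contDiff_proj2 h11 h12 h22
  have cproj := hasCompactSupport_proj2 c11 c12 c22
  have hsplit : (fun y =>
      Tf (u1, u2) (-u1, u2) f11 f12 f22 y - Lf (u1, u2) (-u1, u2) f11 f12 f22 y) = fun y =>
      Xray (u1, u2) (fun z => (u1 ^ 2 - u2 ^ 2) * (f22 z - f11 z) + (-4 * u1 * u2) * f12 z) y +
      Xray (-u1, u2) (fun z => (u1 ^ 2 - u2 ^ 2) * (f22 z - f11 z) + (4 * u1 * u2) * f12 z) y := by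
    funext y
    have hsub := fun {w : ℝ × ℝ} (hw : w ≠ 0) => Xray_sub (hproj (perp w)).continuous
      (cproj (perp w)) (hproj w).continuous (cproj w) hw y
    rw [Tf, Lf, add_sub_add_comm, ← hsub hu, ← hsub hv]
    congr 2 <;> (funext z; simp only [proj2, perp]; ring)
  rw [hsplit, Dw_Dw_Xray_add (by fun_prop) (cF.linear_combination c12 _ _) (by fun_prop)
    (cF.linear_combination c12 _ _) hu hv,
    Dw_linear_combination (hF.differentiable two_ne_zero) (h12.differentiable two_ne_zero),
    Dw_linear_combination (hF.differentiable two_ne_zero) (h12.differentiable two_ne_zero)]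
  simp only [Dw_eq_pdx_pdy _ (u1, u2), Dw_eq_pdx_pdy _ (-u1, u2)]
  ring

/-- `D_u D_v (Mf)` as a combination of first derivatives of `f22 - f11` and `f12`. -/
lemma Dw_Dw_Mf {u1 u2 : ℝ} (hu1 : 0 < u1)
    (h11 : ContDiff ℝ 2 f11) (h12 : ContDiff ℝ 2 f12) (h22 : ContDiff ℝ 2 f22)
    (c11 : HasCompactSupport f11) (c12 : HasCompactSupport f12) (c22 : HasCompactSupport f22)
    (x : ℝ × ℝ) :
    Dw (u1, u2) (Dw (-u1, u2) (Mf (u1, u2) (-u1, u2) f11 f12 f22)) x =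
      (2 * u1 ^ 2 * u2) * pdx (fun y => f22 y - f11 y) x +
        (-2 * u2 * (u1 ^ 2 - u2 ^ 2)) * pdy f12 x := by
  have hu : ((u1, u2) : ℝ × ℝ) ≠ 0 := fun h => hu1.ne' (congrArg Prod.fst h)
  have hv : ((-u1, u2) : ℝ × ℝ) ≠ 0 := fun h => hu1.ne' (neg_eq_zero.mp (congrArg Prod.fst h))
  have hF : ContDiff ℝ 2 fun y => f22 y - f11 y := h22.sub h11
  have cF : HasCompactSupport fun y => f22 y - f11 y := c22.sub c11
  have hsplit : Mf (u1, u2) (-u1, u2) f11 f12 f22 = fun y =>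
      Xray (u1, u2) (fun z => (u1 * u2) * (f22 z - f11 z) + (u1 ^ 2 - u2 ^ 2) * f12 z) y +
      Xray (-u1, u2) (fun z => (-u1 * u2) * (f22 z - f11 z) + (u1 ^ 2 - u2 ^ 2) * f12 z) y := by
    funext y
    rw [Mf]
    congr 2 <;> (funext z; simp only [projMix]; ring)
  rw [hsplit, Dw_Dw_Xray_add (by fun_prop) (cF.linear_combination c12 _ _) (by fun_prop)
    (cF.linear_combination c12 _ _) hu hv,
    Dw_linear_combination (hF.differentiable two_ne_zero) (h12.differentiable two_ne_zero),
    Dw_linear_combination (hF.differentiable two_ne_zero) (h12.differentiable two_ne_zero)]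
  simp only [Dw_eq_pdx_pdy _ (u1, u2), Dw_eq_pdx_pdy _ (-u1, u2)]
  ring

end Fields

theorem stmt_11 (u1 u2 : ℝ) (hu1 : 0 < u1) (hu2 : 0 < u2) (huv : u1 ^ 2 + u2 ^ 2 = 1)
    (f11 f12 f22 : ℝ × ℝ → ℝ)
    (hf11 : ContDiff ℝ 3 f11) (hf12 : ContDiff ℝ 3 f12) (hf22 : ContDiff ℝ 3 f22)
    (hs11 : tsupport f11 ⊆ unitDisk) (hs12 : tsupport f12 ⊆ unitDisk)
    (hs22 : tsupport f22 ⊆ unitDisk)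
    (hune : u1 ≠ u2) :
    ∀ x : ℝ × ℝ,
      2 * u1 ^ 2 * (1 + (u1 ^ 2 - u2 ^ 2)) * pdx (pdx f12) x +
          (u1 ^ 2 - u2 ^ 2) ^ 2 * pdy (pdy f12) x =
        -((1 / (2 * u2)) *
          (u1 ^ 2 * pdx (Dw (u1, u2) (Dw (-u1, u2) (fun y => Tf (u1, u2) (-u1, u2) f11 f12 f22 y - Lf (u1, u2) (-u1, u2) f11 f12 f22 y))) x +
            (u1 ^ 2 - u2 ^ 2) * pdy (Dw (u1, u2) (Dw (-u1, u2) (Mf (u1, u2) (-u1, u2) f11 f12 f22))) x)) := by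
  intro x
  have c11 := hasCompactSupport_of_tsupport_subset_unitDisk_s11 hs11
  have c12 := hasCompactSupport_of_tsupport_subset_unitDisk_s11 hs12
  have c22 := hasCompactSupport_of_tsupport_subset_unitDisk_s11 hs22
  have h11 : ContDiff ℝ 2 f11 := hf11.of_le (by norm_num)
  have h12 : ContDiff ℝ 2 f12 := hf12.of_le (by norm_num)
  have h22 : ContDiff ℝ 2 f22 := hf22.of_le (by norm_num)
  have hF : ContDiff ℝ 2 fun y => f22 y - f11 y := h22.sub h11
  have hdiff : ∀ {h : ℝ × ℝ → ℝ}, ContDiff ℝ 2 h → ∀ w, Differentiable ℝ (Dw w h) := fun hh w =>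
    (contDiff_Dw (m := 1) hh (by norm_num) w).differentiable one_ne_zero
  rw [funext (Dw_Dw_Tf_sub_Lf (u2 := u2) hu1 h11 h12 h22 c11 c12 c22),
    funext (Dw_Dw_Mf (u2 := u2) hu1 h11 h12 h22 c11 c12 c22)]
  simp only [pdx, pdy]
  rw [Dw_linear_combination (hdiff hF _) (hdiff h12 _),
    Dw_linear_combination (hdiff hF _) (hdiff h12 _), Dw_comm hF (0, 1) (1, 0)]
  have hu2' : u2 ^ 2 = 1 - u1 ^ 2 := by linarith
  field_simp
  rw [hu2']
  ring
end
end
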